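/- ∫₀^∞ tanh(z)⁶/z⁴ dz = -2852 ζ(5)/(15π⁴) + 5080 ζ(7)/π⁶ - 28616 ζ(9)/π⁸. -/

import Mathlib

open Real MeasureTheory
open Filter Topology
open scoped Nat

/-- The ordinates of the poles of `tanh` in the upper half plane. -/
noncomputable def tanhPole (n : ℕ) : ℝ := (2 * n + 1) * π / 2

lemma tanhPole_pos (n : ℕ) : 0 < tanhPole n := by
  unfold tanhPole; positivity

lemma cast_choose_add_succ (n j : ℕ) :
    ((n + (j + 1)).choose (j + 1) : ℂ) = (n + j + 1) * (n + j).choose j / (j + 1) := by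
  rw [eq_div_iff (Nat.cast_add_one_ne_zero j)]
  exact_mod_cast (Nat.add_one_mul_choose_eq (n + j) j).symm

lemma tsum_mul_geometric {r : ℂ} (hr : ‖r‖ < 1) :
    ∑' n : ℕ, (n : ℂ) ^ 1 * r ^ n = 1 / (1 - r) ^ 2 - 1 / (1 - r) := by
  have h := fun k ↦ hasSum_choose_mul_geometric_of_norm_lt_one k hr
  convert! ((h 1).sub (h 0)).tsum_eq using 1
  · refine tsum_congr fun n ↦ ?_
    simp only [cast_choose_add_succ, Nat.choose_zero_right, Nat.cast_zero, Nat.cast_one]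
    ring
  · ring

lemma tsum_pow_three_mul_geometric {r : ℂ} (hr : ‖r‖ < 1) :
    ∑' n : ℕ, (n : ℂ) ^ 3 * r ^ n =
      6 / (1 - r) ^ 4 - 12 / (1 - r) ^ 3 + 7 / (1 - r) ^ 2 - 1 / (1 - r) := by
  have h := fun k ↦ hasSum_choose_mul_geometric_of_norm_lt_one k hr
  convert! (((((h 3).mul_left 6).sub ((h 2).mul_left 12)).add ((h 1).mul_left 7)).sub
    (h 0)).tsum_eq using 1
  · refine tsum_congr fun n ↦ ?_
    simp only [cast_choose_add_succ, Nat.choose_zero_right, Nat.cast_zero, Nat.cast_one,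
      Nat.cast_ofNat]
    ring
  · ring

lemma tsum_pow_five_mul_geometric {r : ℂ} (hr : ‖r‖ < 1) :
    ∑' n : ℕ, (n : ℂ) ^ 5 * r ^ n =
      120 / (1 - r) ^ 6 - 360 / (1 - r) ^ 5 + 390 / (1 - r) ^ 4 - 180 / (1 - r) ^ 3
        + 31 / (1 - r) ^ 2 - 1 / (1 - r) := by
  have h := fun k ↦ hasSum_choose_mul_geometric_of_norm_lt_one k hr
  convert! (((((((h 5).mul_left 120).sub ((h 4).mul_left 360)).add ((h 3).mul_left 390)).sub
    ((h 2).mul_left 180)).add ((h 1).mul_left 31)).sub (h 0)).tsum_eq using 1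
  · refine tsum_congr fun n ↦ ?_
    simp only [cast_choose_add_succ, Nat.choose_zero_right, Nat.cast_zero, Nat.cast_one,
      Nat.cast_ofNat]
    ring
  · ring

lemma hasSum_tanhPole_pow {k : ℕ} (hk : 1 ≤ k) {z : ℝ} (hz : 0 < z) :
    HasSum (fun n : ℕ ↦ 1 / ((z : ℂ) - Complex.I * tanhPole n) ^ (k + 1) +
        1 / ((z : ℂ) + Complex.I * tanhPole n) ^ (k + 1))
      (2 ^ (k + 1) / k ! * ∑' n : ℕ, (n : ℂ) ^ k * (-(rexp (-2 * z) : ℂ)) ^ n) := by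
  have hπ : (π : ℂ) ≠ 0 := by exact_mod_cast pi_ne_zero
  have him : 0 < (1 / 2 + Complex.I * z / π : ℂ).im := by
    have : (1 / 2 + Complex.I * z / π : ℂ) = ((1 / 2 : ℝ) : ℂ) + (z / π : ℝ) * Complex.I := by
      push_cast; ring
    rw [this]
    simp
    positivity
  let τ : UpperHalfPlane := ⟨_, him⟩
  have hτ : (τ : ℂ) = 1 / 2 + Complex.I * z / π := rfl
  have hq := EisensteinSeries.qExpansion_identity hk τ
  have hs : Summable fun n : ℤ ↦ 1 / ((τ : ℂ) + n) ^ (k + 1) := by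
    have := EisensteinSeries.linear_right_summable (τ : ℂ) 1 (k := (k + 1 : ℕ)) (by lia)
    simpa only [Int.cast_one, one_mul, zpow_natCast, one_div] using this
  have hexp : Complex.exp (2 * π * Complex.I * τ) = -(rexp (-2 * z) : ℂ) := by
    rw [hτ, show 2 * π * Complex.I * (1 / 2 + Complex.I * z / π) =
      π * Complex.I + ((-2 * z : ℝ) : ℂ) by
        push_cast; field_simp; ring_nf; rw [Complex.I_sq]; ring, Complex.exp_add,
      Complex.exp_pi_mul_I, Complex.ofReal_exp]
    ring
  rw [hexp] at hq
  have h := hs.hasSum.nat_add_neg_add_one.mul_left ((Complex.I / π) ^ (k + 1))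
  rw [hq] at h
  convert! h using 1
  · ext n
    have e1 : (τ : ℂ) + ((n : ℤ) : ℂ) = (Complex.I / π) * (z - Complex.I * tanhPole n) := by
      rw [hτ]; unfold tanhPole; push_cast; field_simp; ring_nf; rw [Complex.I_sq]; ring
    have e2 : (τ : ℂ) + ((-((n : ℤ) + 1) : ℤ) : ℂ) =
        (Complex.I / π) * (z + Complex.I * tanhPole n) := by
      rw [hτ]; unfold tanhPole; push_cast; field_simp; ring_nf; rw [Complex.I_sq]; ring
    have hI : (Complex.I / π) ^ (k + 1) ≠ 0 := pow_ne_zero _ (div_ne_zero Complex.I_ne_zero hπ)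
    rw [e1, e2, mul_pow, mul_pow, mul_add, mul_one_div, mul_one_div,
      div_mul_cancel_left₀ hI, div_mul_cancel_left₀ hI, one_div, one_div]
  · rw [← mul_assoc, ← mul_div_assoc, ← mul_pow]
    congr 4
    field_simp
    rw [Complex.I_sq]; ring

lemma hasSum_tanh_pow_six {z : ℝ} (hz : 0 < z) :
    HasSum (fun n ↦
      2 * (23 / 15 * ((z ^ 2 - tanhPole n ^ 2) / (z ^ 2 + tanhPole n ^ 2) ^ 2)
      + 2 * ((z ^ 4 - 6 * z ^ 2 * tanhPole n ^ 2 + tanhPole n ^ 4) / (z ^ 2 + tanhPole n ^ 2) ^ 4)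
      + (z ^ 6 - 15 * z ^ 4 * tanhPole n ^ 2 + 15 * z ^ 2 * tanhPole n ^ 4 - tanhPole n ^ 6)
        / (z ^ 2 + tanhPole n ^ 2) ^ 6)) (tanh z ^ 6 - 1) := by
  rw [← Complex.hasSum_ofReal]
  have hr : ‖-(rexp (-2 * z) : ℂ)‖ < 1 := by
    rw [norm_neg, Complex.norm_real, Real.norm_eq_abs, abs_of_pos (exp_pos _), exp_lt_one_iff]
    linarith
  have h1 := hasSum_tanhPole_pow le_rfl hz
  have h3 := hasSum_tanhPole_pow (show 1 ≤ 3 by simp) hz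
  have h5 := hasSum_tanhPole_pow (show 1 ≤ 5 by simp) hz
  rw [tsum_mul_geometric hr] at h1
  rw [tsum_pow_three_mul_geometric hr] at h3
  rw [tsum_pow_five_mul_geometric hr] at h5
  convert! ((h1.mul_left (23 / 15)).add (h3.mul_left 2)).add h5 using 1
  · ext n
    set a := tanhPole n
    have ha : 0 < a := tanhPole_pos n
    have hm : (z : ℂ) - Complex.I * a ≠ 0 := fun h ↦ by
      have := congrArg Complex.re h; simp at this; exact hz.ne' this
    have hp : (z : ℂ) + Complex.I * a ≠ 0 := fun h ↦ by
      have := congrArg Complex.re h; simp at this; exact hz.ne' this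
    have hmul : (z : ℂ) ^ 2 + (a : ℂ) ^ 2 = (z - Complex.I * a) * (z + Complex.I * a) := by
      ring_nf; rw [Complex.I_sq]; ring
    push_cast
    rw [hmul]
    generalize hu : (z : ℂ) - Complex.I * a = u at *
    generalize hv : (z : ℂ) + Complex.I * a = v at *
    have hz' : (z : ℂ) = (u + v) / 2 := by rw [← hu, ← hv]; ring
    have ha' : (a : ℂ) ^ 2 = - ((v - u) / 2) ^ 2 := by
      rw [← hu, ← hv]; ring_nf; rw [Complex.I_sq]; ring
    have ha4 : (a : ℂ) ^ 4 = ((v - u) / 2) ^ 4 := by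
      rw [show (a : ℂ) ^ 4 = (a ^ 2) ^ 2 by ring, ha']; ring
    have ha6 : (a : ℂ) ^ 6 = -((v - u) / 2) ^ 6 := by
      rw [show (a : ℂ) ^ 6 = (a ^ 2) ^ 3 by ring, ha']; ring
    rw [ha4, ha6, ha', hz']
    field_simp
    ring
  · have ht : tanh z = 2 / (1 + rexp (-2 * z)) - 1 := by
      have e : rexp (-2 * z) = rexp (-z) * rexp (-z) := by rw [← exp_add]; ring_nf
      have e' : rexp z = (rexp (-z))⁻¹ := by rw [exp_neg, inv_inv]
      rw [tanh_eq_sinh_div_cosh, sinh_eq, cosh_eq, e, e']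
      have := exp_pos (-z)
      field_simp
      ring
    have hne : (1 : ℂ) + rexp (-2 * z) ≠ 0 := by
      have := exp_pos (-2 * z)
      exact_mod_cast (by positivity : 1 + rexp (-2 * z) ≠ 0)
    rw [ht]
    simp only [sub_neg_eq_add, Nat.factorial]
    simp only [Complex.ofReal_sub, Complex.ofReal_pow, Complex.ofReal_div, Complex.ofReal_add]
    generalize (rexp (-2 * z) : ℂ) = ρ at *
    push_cast
    field_simp
    ring

lemma hasSum_inv_tanhPole_pow {s : ℕ} {S : ℝ}
    (h : HasSum (fun n : ℕ ↦ 1 / (n : ℝ) ^ s) S) :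
    HasSum (fun n ↦ 1 / tanhPole n ^ s) ((2 ^ s - 1) / π ^ s * S) := by
  have heven : HasSum (fun n : ℕ ↦ 1 / ((2 * n : ℕ) : ℝ) ^ s) (1 / 2 ^ s * S) := by
    convert! h.mul_left (1 / 2 ^ s) using 2 with n
    push_cast
    rw [mul_pow, one_div_mul_one_div]
  have hodd : Summable (fun n : ℕ ↦ 1 / ((2 * n + 1 : ℕ) : ℝ) ^ s) :=
    h.summable.comp_injective (i := fun n ↦ 2 * n + 1) fun a b hab ↦ by simpa using hab
  have hS := h.unique (heven.even_add_odd hodd.hasSum)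
  have hval : (2 ^ s - 1) / π ^ s * S =
      2 ^ s / π ^ s * ∑' n : ℕ, 1 / ((2 * n + 1 : ℕ) : ℝ) ^ s := by
    rw [eq_sub_of_add_eq' hS.symm]
    field_simp
  rw [hval]
  convert! hodd.hasSum.mul_left (2 ^ s / π ^ s) using 2 with n
  unfold tanhPole
  push_cast
  rw [div_pow, mul_pow]
  field_simp

lemma hasSum_zeta_six : HasSum (fun n : ℕ ↦ 1 / (n : ℝ) ^ 6) (π ^ 6 / 945) := by
  have hB : bernoulli 6 = 1 / 42 := by
    rw [bernoulli_eq_bernoulli'_of_ne_one (by decide), bernoulli'_def]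
    norm_num [Finset.sum_range_succ, Nat.choose,
      bernoulli'_eq_zero_of_odd (show Odd 5 by decide) (by decide)]
  convert! hasSum_zeta_nat three_ne_zero using 1
  norm_num [hB, Nat.factorial]
  ring

lemma hasSum_zeta_eight : HasSum (fun n : ℕ ↦ 1 / (n : ℝ) ^ 8) (π ^ 8 / 9450) := by
  have hB6 : bernoulli' 6 = 1 / 42 := by
    rw [bernoulli'_def]
    norm_num [Finset.sum_range_succ, Nat.choose,
      bernoulli'_eq_zero_of_odd (show Odd 5 by decide) (by decide)]
  have hB : bernoulli 8 = -1 / 30 := by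
    rw [bernoulli_eq_bernoulli'_of_ne_one (by decide), bernoulli'_def]
    norm_num [Finset.sum_range_succ, Nat.choose, hB6,
      bernoulli'_eq_zero_of_odd (show Odd 5 by decide) (by decide),
      bernoulli'_eq_zero_of_odd (show Odd 7 by decide) (by decide)]
  convert! hasSum_zeta_nat four_ne_zero using 1
  norm_num [hB, Nat.factorial]
  ring

lemma exists_primitive_inv_one_add_sq_pow (j : ℕ) :
    ∃ G : ℝ → ℝ, G 0 = 0 ∧ (∀ x, HasDerivAt G ((1 + x ^ 2)⁻¹ ^ (j + 1)) x) ∧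
      Tendsto G atTop
        (𝓝 (π / 2 * ∏ i ∈ Finset.range j, ((2 * i + 1) / (2 * i + 2) : ℝ))) := by
  induction j with
  | zero =>
    exact ⟨arctan, arctan_zero, fun x ↦ by simpa using hasDerivAt_arctan x,
      by simpa using tendsto_nhds_of_tendsto_nhdsWithin tendsto_arctan_atTop⟩
  | succ j ih =>
    obtain ⟨G, h0, hd, ht⟩ := ih
    refine ⟨fun x ↦ (x * (1 + x ^ 2)⁻¹ ^ (j + 1) + (2 * j + 1) * G x) / (2 * j + 2), by simp [h0],
      fun x ↦ ?_, ?_⟩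
    · have hx : 1 + x ^ 2 ≠ 0 := by positivity
      have hw : HasDerivAt (fun x : ℝ ↦ (1 + x ^ 2)⁻¹) (-(2 * x) / (1 + x ^ 2) ^ 2) x := by
        convert! ((hasDerivAt_pow 2 x).const_add 1).inv hx using 1
        simp
      convert! (((hasDerivAt_id x).mul (hw.pow (j + 1))).add
        ((hd x).const_mul (2 * j + 1 : ℝ))).div_const (2 * j + 2 : ℝ) using 1
      simp only [id, Nat.add_sub_cancel, inv_pow, Pi.pow_apply]
      have : (2 * j + 2 : ℝ) ≠ 0 := by positivity
      push_cast
      field_simp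
      ring
    · have hz : Tendsto (fun x : ℝ ↦ x * (1 + x ^ 2)⁻¹ ^ (j + 1)) atTop (𝓝 0) := by
        refine squeeze_zero' (eventually_ge_atTop 0 |>.mono fun x hx ↦ by positivity)
          (eventually_gt_atTop 0 |>.mono fun x hx ↦ ?_) tendsto_inv_atTop_zero
        have hle : (1 + x ^ 2)⁻¹ ≤ 1 := inv_le_one_of_one_le₀ (by nlinarith)
        calc x * (1 + x ^ 2)⁻¹ ^ (j + 1) ≤ x * (1 + x ^ 2)⁻¹ := by
              gcongr
              exact pow_le_of_le_one (by positivity) hle (by simp)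
          _ ≤ x⁻¹ := by
              rw [← div_eq_mul_inv, div_le_iff₀ (by positivity)]
              field_simp
              nlinarith
      convert! (hz.add (ht.const_mul (2 * j + 1 : ℝ))).div_const (2 * j + 2 : ℝ) using 2
      rw [Finset.prod_range_succ]
      ring

lemma integrableOn_inv_one_add_sq_pow (j : ℕ) :
    IntegrableOn (fun x : ℝ ↦ (1 + x ^ 2)⁻¹ ^ (j + 1)) (Set.Ioi 0) := by
  obtain ⟨G, -, hd, ht⟩ := exists_primitive_inv_one_add_sq_pow j
  exact integrableOn_Ioi_deriv_of_nonneg' (fun x _ ↦ hd x) (fun x _ ↦ by positivity) ht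

lemma integral_inv_one_add_sq_pow (j : ℕ) :
    ∫ x in Set.Ioi (0 : ℝ), (1 + x ^ 2)⁻¹ ^ (j + 1) =
      π / 2 * ∏ i ∈ Finset.range j, ((2 * i + 1) / (2 * i + 2) : ℝ) := by
  obtain ⟨G, h0, hd, ht⟩ := exists_primitive_inv_one_add_sq_pow j
  rw [integral_Ioi_of_hasDerivAt_of_nonneg' (fun x _ ↦ hd x) (fun x _ ↦ by positivity) ht, h0,
    sub_zero]

/-- A linear combination of the first six powers of `(1 + x ^ 2)⁻¹`. -/
noncomputable def lorentzKernel (c : Fin 6 → ℝ) (x : ℝ) : ℝ :=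
  ∑ j, c j * (1 + x ^ 2)⁻¹ ^ ((j : ℕ) + 1)

lemma integrableOn_lorentzKernel (c : Fin 6 → ℝ) :
    IntegrableOn (lorentzKernel c) (Set.Ioi 0) :=
  integrable_finsetSum _ fun j _ ↦ (integrableOn_inv_one_add_sq_pow j).const_mul (c j)

lemma integral_lorentzKernel (c : Fin 6 → ℝ) :
    ∫ x in Set.Ioi (0 : ℝ), lorentzKernel c x =
      π / 2 * (c 0 + c 1 / 2 + 3 / 8 * c 2 + 5 / 16 * c 3 + 35 / 128 * c 4 + 63 / 256 * c 5) := by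
  unfold lorentzKernel
  rw [integral_finsetSum _ fun (j : Fin 6) _ ↦ (integrableOn_inv_one_add_sq_pow j).const_mul (c j)]
  simp only [integral_const_mul, integral_inv_one_add_sq_pow]
  simp [Fin.sum_univ_six, Finset.prod_range_succ]
  ring

/-- `x ^ (-4)` times the part of `Re (x + i) ^ (-2)` beyond its third order Taylor polynomial. -/
noncomputable abbrev kernelTwo : ℝ → ℝ := lorentzKernel ![-3, -2, 0, 0, 0, 0]

/-- `x ^ (-4)` times the part of `Re (x + i) ^ (-4)` beyond its third order Taylor polynomial. -/
noncomputable abbrev kernelFour : ℝ → ℝ := lorentzKernel ![10, 9, 8, 8, 0, 0]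

/-- `x ^ (-4)` times the part of `Re (x + i) ^ (-6)` beyond its third order Taylor polynomial. -/
noncomputable abbrev kernelSix : ℝ → ℝ := lorentzKernel ![-21, -20, -19, -18, -16, -32]

lemma hasSum_tanh_pow_six_div {z : ℝ} (hz : 0 < z) :
    HasSum (fun n ↦ 46 / 15 * (1 / tanhPole n ^ 6 * kernelTwo ((tanhPole n)⁻¹ * z))
      + 4 * (1 / tanhPole n ^ 8 * kernelFour ((tanhPole n)⁻¹ * z))
      + 2 * (1 / tanhPole n ^ 10 * kernelSix ((tanhPole n)⁻¹ * z))) (tanh z ^ 6 / z ^ 4) := by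
  have h2 := hasSum_inv_tanhPole_pow hasSum_zeta_two
  have h4 := hasSum_inv_tanhPole_pow hasSum_zeta_four
  have h6 := hasSum_inv_tanhPole_pow hasSum_zeta_six
  have h8 := hasSum_inv_tanhPole_pow hasSum_zeta_eight
  have h := ((hasSum_tanh_pow_six hz).sub (((((h2.mul_left (-46 / 15)).add
    (h4.mul_left (4 + 46 / 5 * z ^ 2))).add (h6.mul_left (-2 - 40 * z ^ 2))).add
    (h8.mul_left (42 * z ^ 2))))).mul_left (1 / z ^ 4)
  convert! h using 1
  · ext n
    have ha := tanhPole_pos n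
    generalize tanhPole n = a at *
    simp only [lorentzKernel, Fin.sum_univ_six]
    simp
    have : z ^ 2 + a ^ 2 ≠ 0 := by positivity
    have e : (1 + (a⁻¹ * z) ^ 2)⁻¹ = a ^ 2 / (z ^ 2 + a ^ 2) := by field_simp; ring
    simp only [← inv_pow, e]
    field_simp
    ring
  · field_simp
    ring

lemma integrableOn_scaled {k : ℝ → ℝ} (hk : IntegrableOn k (Set.Ioi 0)) {a : ℝ} (ha : 0 < a) :
    IntegrableOn (fun z ↦ k (a⁻¹ * z)) (Set.Ioi 0) := by
  rw [integrableOn_Ioi_comp_mul_left_iff k 0 (inv_pos.2 ha)]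
  simpa using hk

lemma integral_scaled (k : ℝ → ℝ) (m : ℕ) {a : ℝ} (ha : 0 < a) :
    ∫ z in Set.Ioi 0, 1 / a ^ (m + 1) * k (a⁻¹ * z) = 1 / a ^ m * ∫ x in Set.Ioi 0, k x := by
  rw [integral_const_mul, integral_comp_mul_left_Ioi k 0 (inv_pos.2 ha)]
  simp only [mul_zero, inv_inv, smul_eq_mul]
  field_simp
  ring

lemma summable_inv_tanhPole_pow {s : ℕ} (hs : 1 < s) : Summable (fun n ↦ 1 / tanhPole n ^ s) :=
  (hasSum_inv_tanhPole_pow (Real.summable_one_div_nat_pow.2 hs).hasSum).summable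

lemma integral_tanh_pow_six_div :
    ∫ z in Set.Ioi (0 : ℝ), tanh z ^ 6 / z ^ 4 =
      -2852 * (∑' n : ℕ, 1 / (n : ℝ) ^ 5) / (15 * π ^ 4)
        + 5080 * (∑' n : ℕ, 1 / (n : ℝ) ^ 7) / π ^ 6
        - 28616 * (∑' n : ℕ, 1 / (n : ℝ) ^ 9) / π ^ 8 := by
  have hint (c : Fin 6 → ℝ) (m n : ℕ) (b : ℝ) : Integrable
      (fun z ↦ b * (1 / tanhPole n ^ m * lorentzKernel c ((tanhPole n)⁻¹ * z)))
      (volume.restrict (Set.Ioi 0)) :=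
    ((integrableOn_scaled (integrableOn_lorentzKernel c) (tanhPole_pos n)).const_mul _).const_mul _
  have hval (c : Fin 6 → ℝ) (m n : ℕ) (b : ℝ) :
      ∫ z in Set.Ioi 0, b * (1 / tanhPole n ^ (m + 1) * lorentzKernel c ((tanhPole n)⁻¹ * z)) =
        b * (1 / tanhPole n ^ m * ∫ x in Set.Ioi 0, lorentzKernel c x) := by
    rw [integral_const_mul, integral_scaled _ m (tanhPole_pos n)]
  have hnorm (c : Fin 6 → ℝ) {m : ℕ} (hm : 1 < m) (b : ℝ) : Summable fun n ↦
      ∫ z in Set.Ioi 0, ‖b * (1 / tanhPole n ^ (m + 1) * lorentzKernel c ((tanhPole n)⁻¹ * z))‖ := by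
    refine (((summable_inv_tanhPole_pow hm).mul_right
      (∫ x in Set.Ioi 0, ‖lorentzKernel c x‖)).mul_left ‖b‖).congr fun n ↦ ?_
    have ha := tanhPole_pos n
    rw [← integral_scaled (fun x ↦ ‖lorentzKernel c x‖) m ha, ← integral_const_mul]
    simp only [norm_mul, Real.norm_of_nonneg (show 0 ≤ 1 / tanhPole n ^ (m + 1) by positivity)]
  have hF := hasSum_integral_of_summable_integral_norm (μ := volume.restrict (Set.Ioi 0))
    (F := fun n z ↦ 46 / 15 * (1 / tanhPole n ^ 6 * kernelTwo ((tanhPole n)⁻¹ * z))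
      + 4 * (1 / tanhPole n ^ 8 * kernelFour ((tanhPole n)⁻¹ * z))
      + 2 * (1 / tanhPole n ^ 10 * kernelSix ((tanhPole n)⁻¹ * z)))
    (fun n ↦ ((hint _ 6 n _).add (hint _ 8 n _)).add (hint _ 10 n _)) ?_
  · rw [setIntegral_congr_fun measurableSet_Ioi fun z hz ↦
      (hasSum_tanh_pow_six_div hz).tsum_eq] at hF
    refine hF.unique ?_
    have hsum (s : ℕ) (hs : 1 < s) :=
      hasSum_inv_tanhPole_pow (Real.summable_one_div_nat_pow.2 hs).hasSum
    have h := (((hsum 5 (by simp)).mul_left (-92 / 15 * π)).add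
      ((hsum 7 (by simp)).mul_left (40 * π))).add ((hsum 9 (by simp)).mul_left (-56 * π))
    convert! h using 1
    · ext n
      refine (integral_add ((hint _ 6 n _).add (hint _ 8 n _)) (hint _ 10 n _)).trans ?_
      rw [integral_add' (hint _ 6 n _) (hint _ 8 n _), hval _ 5 n, hval _ 7 n, hval _ 9 n]
      simp only [integral_lorentzKernel]
      simp
      ring
    · field_simp
      ring
  · refine Summable.of_nonneg_of_le (fun n ↦ integral_nonneg fun z ↦ norm_nonneg _) (fun n ↦ ?_)
      (((hnorm ![-3, -2, 0, 0, 0, 0] (show 1 < 5 by simp) (46 / 15)).add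
        (hnorm ![10, 9, 8, 8, 0, 0] (show 1 < 7 by simp) 4)).add
        (hnorm ![-21, -20, -19, -18, -16, -32] (show 1 < 9 by simp) 2))
    rw [← integral_add (hint _ 6 n _).norm (hint _ 8 n _).norm]
    refine le_of_le_of_eq ?_
      (integral_add ((hint _ 6 n _).norm.add (hint _ 8 n _).norm) (hint _ 10 n _).norm)
    exact integral_mono (((hint _ 6 n _).add (hint _ 8 n _)).add (hint _ 10 n _)).norm
      (((hint _ 6 n _).norm.add (hint _ 8 n _).norm).add (hint _ 10 n _).norm)
      fun z ↦ norm_add₃_le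

lemma riemannZeta_eq_ofReal_tsum {k : ℕ} (hk : 1 < k) :
    riemannZeta k = ((∑' n : ℕ, 1 / (n : ℝ) ^ k : ℝ) : ℂ) := by
  rw [zeta_nat_eq_tsum_of_gt_one hk]
  push_cast
  rfl

theorem stmt_7 :
    (↑(∫ z in Set.Ioi (0:ℝ), Real.tanh z ^ 6 / z ^ 4) : ℂ) = -2852 * riemannZeta 5 / (15 * (π:ℂ) ^ 4) + 5080 * riemannZeta 7 / (π:ℂ) ^ 6 - 28616 * riemannZeta 9 / (π:ℂ) ^ 8 := by
  have h5 := riemannZeta_eq_ofReal_tsum (show 1 < 5 by simp)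
  have h7 := riemannZeta_eq_ofReal_tsum (show 1 < 7 by simp)
  have h9 := riemannZeta_eq_ofReal_tsum (show 1 < 9 by simp)
  rw [Nat.cast_ofNat] at h5 h7 h9
  rw [integral_tanh_pow_six_div, h5, h7, h9]
  simp only [Complex.ofReal_add, Complex.ofReal_sub, Complex.ofReal_div, Complex.ofReal_mul,
    Complex.ofReal_pow, Complex.ofReal_neg, Complex.ofReal_ofNat]
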